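/- Let a > 3/4 and η ∈ [−1/4, 1/4]. Set c7(a) = (1/16)·min{a−1/2, 1}, c11(a) = (1/2)·min{a−3/4, 1/6}, c12(a) = min{c7(a), c11(a)}/2, and define ‖(X,X̄,σ,T)‖ := c12(a)·(|X|+|X̄|) and ‖(Z,Γ)‖ := c12(a)·(|Z|+|Γ|). Let Υ : Ω_cycle × ℝ² × Ω_cycle → ℝ be a measurable function satisfying |Υ(ω | Z,Γ | ω')| ≤ c13·exp(‖ω‖ + ‖(Z,Γ)‖ + ‖ω'‖ + H_expII(ω|Z,Γ|ω')) for some constant c13 > 0. Then: (i) for all ω, ω' ∈ Ω_cycle the integral k_η^Υ(ω,ω') := ∫_{ℝ²} Υ(ω|Z,Γ|ω')·e^{−H_middle,a,η(ω|Z,Γ|ω')} dZ dΓ converges absolutely (with e^{−∞} := 0); (ii) there is a constant c14 > 0 (depending on a and c13) with |k_η^Υ(ω,ω')| ≤ c14·e^{−‖ω‖−‖ω'‖} for all ω, ω'; (iii) ∫∫ k_η^Υ(ω,ω')² dω dω' < ∞, where dω is Lebesgue measure on the real coordinates times counting measure on {−1,+1}×{A,B,C,D}; hence the associated integral operator on L²(Ω_cycle,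 dω) is a Hilbert–Schmidt operator. -/

import Mathlib

open MeasureTheory Real

/-- Tree labels A, B, C, D encoded as `Fin 4`. -/
abbrev TreeLabel := Fin 4

def lA : TreeLabel := 0
def lB : TreeLabel := 1
def lC : TreeLabel := 2
def lD : TreeLabel := 3

/-- A cycle configuration `(X, X̄, σ, T)`; the sign `σ` is encoded as a `Bool`. -/
abbrev CycleConfig := ℝ × ℝ × Bool × TreeLabel

/-- The numerical value of a sign. -/
noncomputable def sgnv (b : Bool) : ℝ := if b then 1 else -1

/-- Real-valued indicator of a proposition. -/
noncomputable def indR (p : Prop) [Decidable p] : ℝ := if p then 1 else 0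

/-- `U = (X + X̄)/2`. -/
noncomputable def Uof (ω : CycleConfig) : ℝ := (ω.1 + ω.2.1) / 2

/-- `W = Γ + U' − U`. -/
noncomputable def Wof (ω : CycleConfig) (Γ : ℝ) (ω' : CycleConfig) : ℝ :=
  Γ + Uof ω' - Uof ω

noncomputable def Hln (a : ℝ) (ω : CycleConfig) (Z Γ : ℝ) (ω' : CycleConfig) : ℝ :=
  ((3 * a + 1) / 2) *
    (Real.log (exp (ω.1 + Wof ω Γ ω' / 2) + exp (ω'.1 - Wof ω Γ ω' / 2) + exp Z)
      + Real.log (exp (ω.2.1 + Wof ω Γ ω' / 2) + exp (ω'.2.1 - Wof ω Γ ω' / 2) + exp Z))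

noncomputable def Hlinear (a : ℝ) (ω : CycleConfig) (Z : ℝ) (ω' : CycleConfig) : ℝ :=
  -(a + 1 / 2) * (Uof ω + Uof ω' + Z)

noncomputable def Htree (ω : CycleConfig) (Z Γ : ℝ) (ω' : CycleConfig) : ℝ :=
  (1 / 2) * (indR (ω.2.2.2 = lC) * ω.1 + indR (ω.2.2.2 = lD) * ω.2.1
      + indR (ω'.2.2.2 = lC) * ω'.1 + indR (ω'.2.2.2 = lD) * ω'.2.1)
    + (indR (ω'.2.2.2 = lB) + indR (ω.2.2.2 = lA)) * Z
    + (1 / 2) * (indR (ω'.2.2.2 = lB) - indR (ω.2.2.2 = lA)) * Wof ω Γ ω'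
    - (1 / 2) * (indR (ω.2.2.2 = lA) - indR (ω.2.2.2 = lB)) * Uof ω
    + (1 / 2) * (indR (ω'.2.2.2 = lA) - indR (ω'.2.2.2 = lB)) * Uof ω'

noncomputable def HexpI (ω : CycleConfig) (ω' : CycleConfig) : ℝ :=
  (1 / 4) * (exp (-ω.1) + exp (-ω.2.1) + exp (-ω'.1) + exp (-ω'.2.1))

noncomputable def HexpII (ω : CycleConfig) (Z Γ : ℝ) (ω' : CycleConfig) : ℝ :=
  (1 / 2) * (sgnv ω.2.2.1 * exp (Wof ω Γ ω' / 4) - sgnv ω'.2.2.1 * exp (-Wof ω Γ ω' / 4)) ^ 2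
    * exp (-Z)

/-- The (finite part of the) middle Hamiltonian `H_middle,a,η`. -/
noncomputable def Hmid (a η : ℝ) (ω : CycleConfig) (Z Γ : ℝ) (ω' : CycleConfig) : ℝ :=
  Hln a ω Z Γ ω' + Hlinear a ω Z ω' + Htree ω Z Γ ω' + HexpI ω ω' + HexpII ω Z Γ ω' - η * Γ

/-- The left boundary Hamiltonian `H_left,a(Z|ω)`. -/
noncomputable def Hleft (a : ℝ) (Z : ℝ) (ω : CycleConfig) : ℝ :=
  a * Real.log (exp ω.2.1 + exp Z)
    + (a + 1 / 2) * (Real.log (exp ω.1 + exp Z) - Uof ω - Z)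
    + (1 / 2) * (indR (ω.2.2.2 = lC) * ω.1 + indR (ω.2.2.2 = lD) * ω.2.1)
    + indR (ω.2.2.2 = lB) * Z
    + (1 / 2) * (indR (ω.2.2.2 = lA) - indR (ω.2.2.2 = lB)) * Uof ω
    + (1 / 4) * (exp (-ω.1) + exp (-ω.2.1)) + (1 / 2) * exp (-Z)
    + Uof ω / 4

/-- The right boundary Hamiltonian `H_right,a(ω|Z)`. -/
noncomputable def Hright (a : ℝ) (ω : CycleConfig) (Z : ℝ) : ℝ :=
  (a + 1 / 2) * (Real.log (exp ω.1 + exp Z) + Real.log (exp ω.2.1 + exp Z) - Uof ω - Z)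
    + (1 / 2) * (indR (ω.2.2.2 = lC) * ω.1 + indR (ω.2.2.2 = lD) * ω.2.1)
    + indR (ω.2.2.2 = lA) * Z
    - (1 / 2) * (indR (ω.2.2.2 = lA) - indR (ω.2.2.2 = lB)) * Uof ω
    + (1 / 4) * (exp (-ω.1) + exp (-ω.2.1)) + (1 / 2) * exp (-Z)
    - Uof ω / 4

noncomputable instance : MeasureSpace Bool := ⟨Measure.count⟩
noncomputable instance : MeasureSpace TreeLabel := ⟨Measure.count⟩

/-- The constant `c₇(a) = (1/16)·min{a − 1/2, 1}`. -/
noncomputable def c7 (a : ℝ) : ℝ := (1 / 16) * min (a - 1 / 2) 1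

/-- The constant `c₁₁(a) = (1/2)·min{a − 3/4, 1/6}`. -/
noncomputable def c11 (a : ℝ) : ℝ := (1 / 2) * min (a - 3 / 4) (1 / 6)

/-- The constant `c₁₂(a) = min{c₇(a), c₁₁(a)}/2`. -/
noncomputable def c12 (a : ℝ) : ℝ := min (c7 a) (c11 a) / 2

/-- `‖(X, X̄, σ, T)‖ = c₁₂(a)·(|X| + |X̄|)`. -/
noncomputable def cycNorm (a : ℝ) (ω : CycleConfig) : ℝ := c12 a * (|ω.1| + |ω.2.1|)

/-- `‖(Z, Γ)‖ = c₁₂(a)·(|Z| + |Γ|)`. -/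
noncomputable def rungNorm (a : ℝ) (Z Γ : ℝ) : ℝ := c12 a * (|Z| + |Γ|)

/-- The Boltzmann weight `e^{−H_middle,a,η}`, with the convention `e^{−∞} = 0` when the
constraint `(T, T') ≠ (A, B)` is violated. -/
noncomputable def wMid (a η : ℝ) (ω : CycleConfig) (Z Γ : ℝ) (ω' : CycleConfig) : ℝ :=
  if ω.2.2.2 = lA ∧ ω'.2.2.2 = lB then 0 else exp (-Hmid a η ω Z Γ ω')


theorem log3_bound (b p q r x y z : ℝ) (hp : 0 ≤ p) (hq : 0 ≤ q) (hr : 0 ≤ r)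
    (hs : p + q + r = b) :
    p * x + q * y + r * z ≤ b * Real.log (exp x + exp y + exp z) := by
  have ex := exp_pos x
  have ey := exp_pos y
  have ez := exp_pos z
  have h1 : x ≤ Real.log (exp x + exp y + exp z) := by
    rw [Real.le_log_iff_exp_le (by positivity)]; linarith
  have h2 : y ≤ Real.log (exp x + exp y + exp z) := by
    rw [Real.le_log_iff_exp_le (by positivity)]; linarith
  have h3 : z ≤ Real.log (exp x + exp y + exp z) := by
    rw [Real.le_log_iff_exp_le (by positivity)]; linarith
  rw [← hs]
  nlinarith [mul_le_mul_of_nonneg_left h1 hp, mul_le_mul_of_nonneg_left h2 hq,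
    mul_le_mul_of_nonneg_left h3 hr]

theorem lin_exp_bound (c k M x : ℝ) (h1 : c ≤ k) (h2 : k ≤ M) :
    c * |x| - 2 * (c + M) ^ 2 ≤ k * x + (1 / 4) * exp (-x) := by
  have e0 := exp_pos (-x)
  rcases le_total 0 x with hx | hx
  · rw [abs_of_nonneg hx]
    nlinarith [mul_le_mul_of_nonneg_right h1 hx, sq_nonneg (c + M)]
  · rw [abs_of_nonpos hx]
    have hq := Real.quadratic_le_exp_of_nonneg (x := -x) (by linarith)
    have := mul_le_mul_of_nonneg_right h2 (show 0 ≤ -x by linarith)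
    nlinarith [sq_nonneg (-x - 4 * (c + M))]

theorem ind_cases (T : TreeLabel) :
    (T = lA ∧ indR (T = lA) = 1 ∧ indR (T = lB) = 0 ∧ indR (T = lC) = 0 ∧ indR (T = lD) = 0) ∨
    (T = lB ∧ indR (T = lA) = 0 ∧ indR (T = lB) = 1 ∧ indR (T = lC) = 0 ∧ indR (T = lD) = 0) ∨
    (indR (T = lA) = 0 ∧ indR (T = lB) = 0 ∧ indR (T = lC) = 1 ∧ indR (T = lD) = 0) ∨
    (indR (T = lA) = 0 ∧ indR (T = lB) = 0 ∧ indR (T = lC) = 0 ∧ indR (T = lD) = 1) := by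
  fin_cases T <;> simp [indR, lA, lB, lC, lD, Fin.ext_iff]

set_option maxHeartbeats 4000000 in
theorem mult_fin (a c w z : ℝ) (hc0 : 0 ≤ c) (hc1 : c ≤ 1 / 16) (hca : 2 * c ≤ a - 3 / 4)
    (hw1 : -(1 / 4) - c ≤ w) (hw2 : w ≤ 1 / 4 + c) (hz1 : -c ≤ z) (hz2 : z ≤ c)
    (A B C D A' B' C' D' e d d' S Q : ℝ)
    (he : e = -((C - D + C' - D') * (A + B') * (1 / 16 - c / 4)))
    (hd : d = (C - D) / 4 + e) (hd' : d' = (C' - D') / 4 + e)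
    (hS : S = a + 1 / 4 + A + w - z / 2) (hQ : Q = a + 1 / 4 + B' - w - z / 2)
    (h : (A = 1 ∧ B = 0 ∧ C = 0 ∧ D = 0) ∨ (A = 0 ∧ B = 1 ∧ C = 0 ∧ D = 0) ∨
      (A = 0 ∧ B = 0 ∧ C = 1 ∧ D = 0) ∨ (A = 0 ∧ B = 0 ∧ C = 0 ∧ D = 1))
    (h' : (A' = 1 ∧ B' = 0 ∧ C' = 0 ∧ D' = 0) ∨ (A' = 0 ∧ B' = 1 ∧ C' = 0 ∧ D' = 0) ∨
      (A' = 0 ∧ B' = 0 ∧ C' = 1 ∧ D' = 0) ∨ (A' = 0 ∧ B' = 0 ∧ C' = 0 ∧ D' = 1))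
    (hn : A + B' ≤ 1) :
    ∃ p p' q q' r r' : ℝ, 0 ≤ p ∧ 0 ≤ p' ∧ 0 ≤ q ∧ 0 ≤ q' ∧ 0 ≤ r ∧ 0 ≤ r' ∧
      p + q + r = (3 * a + 1) / 2 ∧ p' + q' + r' = (3 * a + 1) / 2 ∧
      r + r' - (a + 1 / 2) + (B' + A) = z ∧
      (p + p' - q - q') / 2 + (B' - A) / 2 = w ∧
      c ≤ p - (a + 1 / 2) / 2 + C / 2
        - (A - B) / 4 - w / 2 ∧
      c ≤ p' - (a + 1 / 2) / 2 + D / 2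
        - (A - B) / 4 - w / 2 ∧
      c ≤ q - (a + 1 / 2) / 2 + C' / 2
        + (A' - B') / 4 + w / 2 ∧
      c ≤ q' - (a + 1 / 2) / 2 + D' / 2
        + (A' - B') / 4 + w / 2 := by
  refine ⟨S / 2 - d, S / 2 + d, Q / 2 - d', Q / 2 + d',
    (3 * a + 1) / 2 - (S / 2 - d) - (Q / 2 - d'),
    (3 * a + 1) / 2 - (S / 2 + d) - (Q / 2 + d'), ?_⟩
  rcases h with ⟨rfl, rfl, rfl, rfl⟩ | ⟨rfl, rfl, rfl, rfl⟩ | ⟨rfl, rfl, rfl, rfl⟩ |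
      ⟨rfl, rfl, rfl, rfl⟩ <;>
    rcases h' with ⟨rfl, rfl, rfl, rfl⟩ | ⟨rfl, rfl, rfl, rfl⟩ | ⟨rfl, rfl, rfl, rfl⟩ |
      ⟨rfl, rfl, rfl, rfl⟩ <;>
    first
    | (exfalso; norm_num at hn; done)
    | (ring_nf at he
       subst he
       refine ⟨?_, ?_, ?_, ?_, ?_, ?_, ?_, ?_, ?_, ?_, ?_, ?_, ?_, ?_⟩ <;> linarith)

theorem mult_exists (a c w z : ℝ) (hc0 : 0 ≤ c) (hc1 : c ≤ 1 / 16) (hca : 2 * c ≤ a - 3 / 4)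
    (hw1 : -(1 / 4) - c ≤ w) (hw2 : w ≤ 1 / 4 + c) (hz1 : -c ≤ z) (hz2 : z ≤ c)
    (T T' : TreeLabel) (h : ¬ (T = lA ∧ T' = lB)) :
    ∃ p p' q q' r r' : ℝ, 0 ≤ p ∧ 0 ≤ p' ∧ 0 ≤ q ∧ 0 ≤ q' ∧ 0 ≤ r ∧ 0 ≤ r' ∧
      p + q + r = (3 * a + 1) / 2 ∧ p' + q' + r' = (3 * a + 1) / 2 ∧
      r + r' - (a + 1 / 2) + (indR (T' = lB) + indR (T = lA)) = z ∧
      (p + p' - q - q') / 2 + (indR (T' = lB) - indR (T = lA)) / 2 = w ∧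
      c ≤ p - (a + 1 / 2) / 2 + indR (T = lC) / 2
        - (indR (T = lA) - indR (T = lB)) / 4 - w / 2 ∧
      c ≤ p' - (a + 1 / 2) / 2 + indR (T = lD) / 2
        - (indR (T = lA) - indR (T = lB)) / 4 - w / 2 ∧
      c ≤ q - (a + 1 / 2) / 2 + indR (T' = lC) / 2
        + (indR (T' = lA) - indR (T' = lB)) / 4 + w / 2 ∧
      c ≤ q' - (a + 1 / 2) / 2 + indR (T' = lD) / 2
        + (indR (T' = lA) - indR (T' = lB)) / 4 + w / 2 := by
  refine mult_fin a c w z hc0 hc1 hca hw1 hw2 hz1 hz2 _ _ _ _ _ _ _ _ _ _ _ _ _ rfl rfl rfl rfl rfl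
    ?_ ?_ ?_
  · have := ind_cases T
    tauto
  · have := ind_cases T'
    tauto
  · rcases ind_cases T with h1 | h1 | h1 | h1 <;>
      rcases ind_cases T' with h2 | h2 | h2 | h2 <;>
      first
      | (exfalso; exact h ⟨h1.1, h2.1⟩)
      | (simp only [h1, h2]; norm_num; done)
      | (have e1 : indR (T = lA) ≤ 1 := by unfold indR; split_ifs <;> norm_num
         have e2 : indR (T' = lB) = 0 := by tauto
         linarith)
      | (have e1 : indR (T' = lB) ≤ 1 := by unfold indR; split_ifs <;> norm_num
         have e2 : indR (T = lA) = 0 := by tauto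
         linarith)

theorem sign_choice (c x : ℝ) (hc : 0 ≤ c) : ∃ g : ℝ, -c ≤ g ∧ g ≤ c ∧ g * x = c * |x| := by
  rcases le_total 0 x with hx | hx
  · exact ⟨c, by linarith, le_refl _, by rw [abs_of_nonneg hx]⟩
  · exact ⟨-c, le_refl _, by linarith, by rw [abs_of_nonpos hx]; ring⟩

theorem indR_nonneg (p : Prop) [Decidable p] : 0 ≤ indR p := by
  unfold indR; split_ifs <;> norm_num

theorem indR_le_one (p : Prop) [Decidable p] : indR p ≤ 1 := by
  unfold indR; split_ifs <;> norm_num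

theorem pointwise_bound (a c η : ℝ) (hc0 : 0 ≤ c) (hc1 : c ≤ 1 / 16) (hca : 2 * c ≤ a - 3 / 4)
    (hη₁ : -(1 / 4) ≤ η) (hη₂ : η ≤ 1 / 4) (ω ω' : CycleConfig) (Z Γ : ℝ)
    (h : ¬ (ω.2.2.2 = lA ∧ ω'.2.2.2 = lB)) :
    c * (|ω.1| + |ω.2.1| + |ω'.1| + |ω'.2.1| + |Z| + |Γ|) - 8 * (c + (3 * a + 4)) ^ 2 ≤
      Hmid a η ω Z Γ ω' - HexpII ω Z Γ ω' := by
  obtain ⟨X, Y, σ, T⟩ := ω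
  obtain ⟨X', Y', σ', T'⟩ := ω'
  obtain ⟨g, hg1, hg2, hg⟩ := sign_choice c Γ hc0
  obtain ⟨z, hz1, hz2, hz⟩ := sign_choice c Z hc0
  obtain ⟨p, p', q, q', r, r', hp, hp', hq, hq', hr, hr', hs, hs', eZ, eW, k1, k2, k3, k4⟩ :=
    mult_exists a c (η + g) z hc0 hc1 hca (by linarith) (by linarith) hz1 hz2 T T' h
  simp only [Hmid, Hln, Hlinear, Htree, HexpI]
  set W := Wof (X, Y, σ, T) Γ (X', Y', σ', T') with hW
  have hW' : W = Γ + (X' + Y') / 2 - (X + Y) / 2 := by simp [hW, Wof, Uof]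
  have l1 := log3_bound _ p q r (X + W / 2) (X' - W / 2) Z hp hq hr hs
  have l2 := log3_bound _ p' q' r' (Y + W / 2) (Y' - W / 2) Z hp' hq' hr' hs'
  simp only [Uof]
  have A0 := indR_nonneg (T = lA)
  have A1 := indR_le_one (T = lA)
  have B0 := indR_nonneg (T = lB)
  have B1 := indR_le_one (T = lB)
  have C1 := indR_le_one (T = lC)
  have D1 := indR_le_one (T = lD)
  have A0' := indR_nonneg (T' = lA)
  have A1' := indR_le_one (T' = lA)
  have B0' := indR_nonneg (T' = lB)
  have B1' := indR_le_one (T' = lB)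
  have C1' := indR_le_one (T' = lC)
  have D1' := indR_le_one (T' = lD)
  have m1 := lin_exp_bound c _ (3 * a + 4) X k1 (by linarith)
  have m2 := lin_exp_bound c _ (3 * a + 4) Y k2 (by linarith)
  have m3 := lin_exp_bound c _ (3 * a + 4) X' k3 (by linarith)
  have m4 := lin_exp_bound c _ (3 * a + 4) Y' k4 (by linarith)
  generalize indR (T = lA) = A at *
  generalize indR (T = lB) = B at *
  generalize indR (T = lC) = C at *
  generalize indR (T = lD) = D at *
  generalize indR (T' = lA) = A' at *
  generalize indR (T' = lB) = B' at *
  generalize indR (T' = lC) = C' at *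
  generalize indR (T' = lD) = D' at *
  have eZ' : (r + r' - (a + 1 / 2) + (B' + A)) * Z = c * |Z| := by rw [eZ, hz]
  have eW' : ((p + p' - q - q') / 2 + (B' - A) / 2) * W = (η + g) * W := by rw [eW]
  have eG : (η + g) * W = η * Γ + c * |Γ| + (η + g) * ((X' + Y') / 2 - (X + Y) / 2) := by
    rw [hW', ← hg]; ring
  linarith

theorem integrable_exp_neg_abs (c : ℝ) (hc : 0 < c) :
    Integrable (fun x : ℝ => exp (-(c * |x|))) := by
  rw [← integrableOn_univ, ← Set.Iic_union_Ioi (a := (0 : ℝ))]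
  refine IntegrableOn.union ?_ ?_
  · refine (integrableOn_exp_mul_Iic hc 0).congr_fun (fun x hx => ?_) measurableSet_Iic
    simp only [Set.mem_Iic] at hx
    simp [abs_of_nonpos hx]
  · refine (integrableOn_exp_mul_Ioi (neg_neg_of_pos hc) 0).congr_fun (fun x hx => ?_)
      measurableSet_Ioi
    simp only [Set.mem_Ioi] at hx
    simp [abs_of_pos hx]

instance : IsFiniteMeasure (volume : Measure Bool) :=
  inferInstanceAs (IsFiniteMeasure (Measure.count : Measure Bool))

instance : IsFiniteMeasure (volume : Measure TreeLabel) :=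
  inferInstanceAs (IsFiniteMeasure (Measure.count : Measure TreeLabel))

theorem integrable_cyc (c : ℝ) (hc : 0 < c) :
    Integrable (fun ω : CycleConfig => exp (-(c * |ω.1|)) * exp (-(c * |ω.2.1|))) := by
  have h2 : Integrable (fun t : ℝ × Bool × TreeLabel => exp (-(c * |t.1|)) * (1 : ℝ)) :=
    (integrable_exp_neg_abs c hc).mul_prod (integrable_const (1 : ℝ))
  simp only [mul_one] at h2
  exact (integrable_exp_neg_abs c hc).mul_prod h2

theorem measurable_Hmid (a η : ℝ) :
    Measurable fun p : CycleConfig × (ℝ × ℝ) × CycleConfig =>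
      wMid a η p.1 p.2.1.1 p.2.1.2 p.2.2 := by
  have hind : ∀ l : TreeLabel, Measurable fun t : TreeLabel => indR (t = l) := fun l =>
    measurable_of_finite _
  have hs : Measurable sgnv := measurable_of_finite _
  have i1 : ∀ l : TreeLabel, Measurable fun p : CycleConfig × (ℝ × ℝ) × CycleConfig =>
    indR (p.1.2.2.2 = l) := fun l => (hind l).comp (by fun_prop)
  have i2 : ∀ l : TreeLabel, Measurable fun p : CycleConfig × (ℝ × ℝ) × CycleConfig =>
    indR (p.2.2.2.2.2 = l) := fun l => (hind l).comp (by fun_prop)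
  have s1 : Measurable fun p : CycleConfig × (ℝ × ℝ) × CycleConfig => sgnv p.1.2.2.1 :=
    hs.comp (by fun_prop)
  have s2 : Measurable fun p : CycleConfig × (ℝ × ℝ) × CycleConfig => sgnv p.2.2.2.2.1 :=
    hs.comp (by fun_prop)
  unfold wMid
  refine Measurable.ite ?_ measurable_const ?_
  · exact (measurableSet_eq_fun (by fun_prop) measurable_const).inter
      (measurableSet_eq_fun (by fun_prop) measurable_const)
  · have a1 := i1 lA
    have a2 := i1 lB
    have a3 := i1 lC
    have a4 := i1 lD
    have b1 := i2 lA
    have b2 := i2 lB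
    have b3 := i2 lC
    have b4 := i2 lD
    unfold Hmid Hln Hlinear Htree HexpI HexpII Wof Uof
    fun_prop

/-- Lemma 4.2: for `a > 3/4`, `η ∈ [−1/4, 1/4]` and a measurable `Υ` satisfying the
exponential bound, (i) the kernel integral `k_η^Υ(ω,ω') = ∫ Υ e^{−H_middle,a,η} dZ dΓ`
converges absolutely, (ii) it is bounded by `c₁₄ e^{−‖ω‖−‖ω'‖}`, and (iii) it is square
integrable on `Ω_cycle × Ω_cycle`; hence it defines a Hilbert–Schmidt operator. -/
theorem kernel_hilbert_schmidt (a η : ℝ) (ha : 3 / 4 < a)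
    (hη₁ : -(1 / 4) ≤ η) (hη₂ : η ≤ 1 / 4)
    (Υ : CycleConfig → ℝ → ℝ → CycleConfig → ℝ)
    (hmeas : Measurable fun p : CycleConfig × (ℝ × ℝ) × CycleConfig =>
      Υ p.1 p.2.1.1 p.2.1.2 p.2.2)
    (c13 : ℝ) (hc13 : 0 < c13)
    (hbound : ∀ (ω : CycleConfig) (Z Γ : ℝ) (ω' : CycleConfig),
      |Υ ω Z Γ ω'| ≤ c13 * exp (cycNorm a ω + rungNorm a Z Γ + cycNorm a ω' + HexpII ω Z Γ ω')) :
    ∃ c14 : ℝ, 0 < c14 ∧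
      (∀ ω ω' : CycleConfig,
        Integrable (fun p : ℝ × ℝ => Υ ω p.1 p.2 ω' * wMid a η ω p.1 p.2 ω') ∧
        |∫ p : ℝ × ℝ, Υ ω p.1 p.2 ω' * wMid a η ω p.1 p.2 ω'| ≤
          c14 * exp (-cycNorm a ω - cycNorm a ω')) ∧
      Integrable (fun q : CycleConfig × CycleConfig =>
        (∫ p : ℝ × ℝ, Υ q.1 p.1 p.2 q.2 * wMid a η q.1 p.1 p.2 q.2) ^ 2) := by
  have hc7 : c12 a * 2 ≤ c7 a := by
    have := min_le_left (c7 a) (c11 a); unfold c12; linarith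
  have hc11 : c12 a * 2 ≤ c11 a := by
    have := min_le_right (c7 a) (c11 a); unfold c12; linarith
  have h7 : c7 a ≤ 1 / 16 := by
    have := min_le_right (a - 1 / 2) 1; unfold c7; linarith
  have h11 : c11 a ≤ (a - 3 / 4) / 2 := by
    have := min_le_left (a - 3 / 4) (1 / 6); unfold c11; linarith
  have hpos : 0 < c12 a := by
    have h1 : 0 < c7 a := by
      unfold c7
      have : 0 < min (a - 1 / 2) 1 := lt_min (by linarith) one_pos
      linarith
    have h2 : 0 < c11 a := by
      unfold c11
      have : 0 < min (a - 3 / 4) (1 / 6) := lt_min (by linarith) (by norm_num)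
      linarith
    have := lt_min h1 h2
    unfold c12
    linarith
  set δ := c12 a with hδ
  set K := 8 * (2 * δ + (3 * a + 4)) ^ 2 with hK
  have hdom : ∀ (ω ω' : CycleConfig) (p : ℝ × ℝ),
      ‖Υ ω p.1 p.2 ω' * wMid a η ω p.1 p.2 ω'‖ ≤
        (c13 * exp K * exp (-cycNorm a ω - cycNorm a ω')) *
          (exp (-(δ * |p.1|)) * exp (-(δ * |p.2|))) := by
    intro ω ω' p
    unfold wMid
    split_ifs with hT
    · simp only [mul_zero, norm_zero]
      positivity
    · have hb := pointwise_bound a (2 * δ) η (by linarith) (by linarith) (by linarith) hη₁ hη₂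
        ω ω' p.1 p.2 hT
      rw [norm_mul, Real.norm_eq_abs, Real.norm_eq_abs, abs_of_pos (exp_pos (-Hmid _ _ _ _ _ _))]
      calc |Υ ω p.1 p.2 ω'| * exp (-Hmid a η ω p.1 p.2 ω')
          ≤ (c13 * exp (cycNorm a ω + rungNorm a p.1 p.2 + cycNorm a ω'
              + HexpII ω p.1 p.2 ω')) * exp (-Hmid a η ω p.1 p.2 ω') :=
            mul_le_mul_of_nonneg_right (hbound ω p.1 p.2 ω') (exp_pos _).le
        _ = c13 * exp (cycNorm a ω + rungNorm a p.1 p.2 + cycNorm a ω'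
              + HexpII ω p.1 p.2 ω' - Hmid a η ω p.1 p.2 ω') := by
            rw [mul_assoc, ← exp_add]; ring_nf
        _ ≤ c13 * exp (K + (-cycNorm a ω - cycNorm a ω') +
              (-(δ * |p.1|) + -(δ * |p.2|))) := by
            refine mul_le_mul_of_nonneg_left (exp_le_exp.mpr ?_) hc13.le
            simp only [cycNorm, rungNorm, ← hδ]
            linarith
        _ = _ := by
            rw [exp_add, exp_add, exp_add (-(δ * |p.1|))]; ring
  have hE : Integrable (fun p : ℝ × ℝ => exp (-(δ * |p.1|)) * exp (-(δ * |p.2|))) :=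
    (integrable_exp_neg_abs δ hpos).mul_prod (integrable_exp_neg_abs δ hpos)
  set I := ∫ p : ℝ × ℝ, exp (-(δ * |p.1|)) * exp (-(δ * |p.2|)) with hI
  have hI0 : 0 ≤ I := integral_nonneg fun p => by positivity
  have hm : Measurable fun p : CycleConfig × (ℝ × ℝ) × CycleConfig =>
      Υ p.1 p.2.1.1 p.2.1.2 p.2.2 * wMid a η p.1 p.2.1.1 p.2.1.2 p.2.2 :=
    hmeas.mul (measurable_Hmid a η)
  have hint : ∀ ω ω' : CycleConfig,
      Integrable (fun p : ℝ × ℝ => Υ ω p.1 p.2 ω' * wMid a η ω p.1 p.2 ω') := by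
    intro ω ω'
    refine (hE.const_mul (c13 * exp K * exp (-cycNorm a ω - cycNorm a ω'))).mono' ?_
      (Filter.Eventually.of_forall (hdom ω ω'))
    have hg : Measurable fun p : ℝ × ℝ => ((ω, p, ω') : CycleConfig × (ℝ × ℝ) × CycleConfig) := by
      fun_prop
    exact (hm.comp hg).aestronglyMeasurable
  have hkb : ∀ ω ω' : CycleConfig,
      |∫ p : ℝ × ℝ, Υ ω p.1 p.2 ω' * wMid a η ω p.1 p.2 ω'| ≤
          (c13 * exp K * (I + 1)) * exp (-cycNorm a ω - cycNorm a ω') := by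
    intro ω ω'
    have h1 := norm_integral_le_of_norm_le
      (hE.const_mul (c13 * exp K * exp (-cycNorm a ω - cycNorm a ω')))
      (Filter.Eventually.of_forall (hdom ω ω'))
    rw [integral_const_mul, Real.norm_eq_abs, ← hI] at h1
    have h2 : 0 ≤ c13 * exp K * exp (-cycNorm a ω - cycNorm a ω') := by positivity
    calc _ ≤ _ := h1
      _ ≤ c13 * exp K * exp (-cycNorm a ω - cycNorm a ω') * (I + 1) :=
        mul_le_mul_of_nonneg_left (by linarith) h2
      _ = _ := by ring
  refine ⟨c13 * exp K * (I + 1), by positivity, fun ω ω' => ⟨hint ω ω', hkb ω ω'⟩, ?_⟩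
  have hC : Integrable (fun q : CycleConfig × CycleConfig =>
      (c13 * exp K * (I + 1)) ^ 2 *
      ((exp (-((2 * δ) * |q.1.1|)) * exp (-((2 * δ) * |q.1.2.1|))) *
        (exp (-((2 * δ) * |q.2.1|)) * exp (-((2 * δ) * |q.2.2.1|))))) :=
    ((integrable_cyc (2 * δ) (by linarith)).mul_prod
      (integrable_cyc (2 * δ) (by linarith))).const_mul _
  refine hC.mono' ?_ (Filter.Eventually.of_forall fun q => ?_)
  · have hg : Measurable fun t : (CycleConfig × CycleConfig) × (ℝ × ℝ) =>
        ((t.1.1, t.2, t.1.2) : CycleConfig × (ℝ × ℝ) × CycleConfig) := by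
      fun_prop
    have := (hm.comp hg).stronglyMeasurable.integral_prod_right' (ν := (volume : Measure (ℝ × ℝ)))
    exact (this.pow 2).aestronglyMeasurable
  · rw [Real.norm_eq_abs, abs_of_nonneg (sq_nonneg _), ← sq_abs]
    refine (pow_le_pow_left₀ (abs_nonneg _) (hkb q.1 q.2) 2).trans (le_of_eq ?_)
    rw [mul_pow, ← exp_add, ← exp_add, ← exp_add, ← exp_nat_mul]
    congr 2
    simp only [cycNorm, ← hδ]
    push_cast
    ring
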